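/- Let ω₁, ω₂, ω₃ be ℝ-linearly independent quaternions with lattice Λ = {w_k : k ∈ ℤ³}, w_k = 2(k₁ω₁ + k₂ω₂ + k₃ω₃), and let ζ₃ be the associated Weierstrass zeta function on ℍ \ Λ. Let ϖ ∈ ℍ satisfy 2ϖ ∈ Λ and ϖ ∉ Λ. Then for every x ∈ ℍ with x ∉ Λ, ζ₃(x + 2ϖ) − ζ₃(x) = 2ζ₃(ϖ) + (iteratedFDeriv ℝ 2 ζ₃ ϖ)(x + ϖ, x + ϖ), i.e. the difference equals 2ζ₃(ϖ) plus the second directional derivative of ζ₃ at ϖ in the direction x + ϖ; in particular the difference is a quaternion-valued polynomial of degree 2 in x. -/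

import Mathlib

noncomputable section

/-- The lattice vector `w_k = 2(k₁ω₁ + k₂ω₂ + k₃ω₃)` in the quaternions. -/
def wk (ω : Fin 3 → Quaternion ℝ) (k : Fin 3 → ℤ) : Quaternion ℝ :=
  2 * ∑ i : Fin 3, (k i : ℝ) • ω i

/-- The Weierstrass zeta function
`ζ₃(x) = x⁻¹ + Σ_{k ≠ 0} [ (x − w_k)⁻¹ + Σ_{μ=0}^{2} (w_k⁻¹x)^μ w_k⁻¹ ]`. -/
def zeta3 (ω : Fin 3 → Quaternion ℝ) (x : Quaternion ℝ) : Quaternion ℝ :=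
  x⁻¹ + ∑' k : {k : Fin 3 → ℤ // k ≠ 0},
    ((x - wk ω k.1)⁻¹ +
      ∑ μ ∈ Finset.range 3, ((wk ω k.1)⁻¹ * x) ^ μ * (wk ω k.1)⁻¹)

open Filter Topology ContinuousLinearMap

theorem summable_norm_inv_pow_four_of_injective {E : Type*} [NormedAddCommGroup E]
    [NormedSpace ℝ E] (φ : (Fin 3 → ℝ) →ₗ[ℝ] E) (hφ : Function.Injective φ) :
    Summable fun k : Fin 3 → ℤ => ‖φ fun i => (k i : ℝ)‖⁻¹ ^ 4 := by
  obtain ⟨K, -, hK⟩ := φ.exists_antilipschitzWith (LinearMap.ker_eq_bot.mpr hφ)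
  let b := Pi.basisFun ℝ (Fin 3)
  let L := Submodule.span ℤ (Set.range b)
  have hL : Summable fun z : L => ‖z‖⁻¹ ^ 4 :=
    ZLattice.summable_norm_pow_inv L 4 (by
      have h : Module.finrank ℤ L = Module.finrank ℝ (Fin 3 → ℝ) := ZLattice.rank ℝ L
      simp [h])
  have hmem (k : Fin 3 → ℤ) : (fun i => (k i : ℝ)) ∈ L := by
    rw [b.mem_span_iff_repr_mem ℤ]
    intro i
    exact ⟨k i, by simp [b]⟩
  have hinj : Function.Injective fun k : Fin 3 → ℤ => (⟨_, hmem k⟩ : L) := by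
    intro k l hkl
    ext i
    simpa using congrFun (congrArg Subtype.val hkl) i
  refine .of_nonneg_of_le (fun _ => by positivity) (fun k => ?_)
    ((hL.comp_injective hinj).mul_left ((K : ℝ) ^ 4))
  rcases eq_or_ne (fun i => (k i : ℝ)) 0 with h0 | h0
  · have : ‖φ fun i => (k i : ℝ)‖⁻¹ ^ 4 = 0 := by rw [h0]; simp
    rw [this]
    exact mul_nonneg (by positivity) (pow_nonneg (inv_nonneg.mpr (norm_nonneg _)) 4)
  have h1 : ‖fun i => (k i : ℝ)‖ ≤ K * ‖φ fun i => (k i : ℝ)‖ := by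
    simpa using hK.le_mul_dist (fun i => (k i : ℝ)) 0
  have h2 : 0 < ‖fun i => (k i : ℝ)‖ := norm_pos_iff.mpr h0
  have h3 : 0 < ‖φ fun i => (k i : ℝ)‖ := norm_pos_iff.mpr fun h => h0 (hφ (by simpa using h))
  change _ ≤ (K : ℝ) ^ 4 * ‖fun i => (k i : ℝ)‖⁻¹ ^ 4
  rw [← mul_pow]
  gcongr
  rw [← div_eq_mul_inv, le_div_iff₀ h2, inv_mul_le_iff₀ h3, mul_comm]
  exact h1

section TwiceDifferentiable

variable {ι E F : Type*} [NormedAddCommGroup E] [NormedSpace ℝ E] [NormedAddCommGroup F]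
  [NormedSpace ℝ F]

theorem norm_le_mul_of_hasFDerivAt_of_norm_le {f : E → F} {f' : E → E →L[ℝ] F} {R C : ℝ}
    (hf : ∀ x ∈ Metric.ball (0 : E) R, HasFDerivAt f (f' x) x)
    (hC : ∀ x ∈ Metric.ball (0 : E) R, ‖f' x‖ ≤ C) (hf0 : f 0 = 0)
    {x : E} (hx : x ∈ Metric.ball (0 : E) R) : ‖f x‖ ≤ C * R := by
  have hR : 0 < R := Metric.pos_of_mem_ball hx
  have h0 : (0 : E) ∈ Metric.ball (0 : E) R := Metric.mem_ball_self hR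
  have h := (convex_ball (0 : E) R).norm_image_sub_le_of_norm_hasFDerivWithin_le
    (fun y hy => (hf y hy).hasFDerivWithinAt) hC h0 hx
  rw [hf0, sub_zero, sub_zero] at h
  refine h.trans ?_
  have := (norm_nonneg _).trans (hC 0 h0)
  gcongr
  simpa using (Metric.mem_ball.mp hx).le

/-- Termwise second differentiation of a series whose terms, outside a finite set of indices,
vanish to second order at the origin and have summably bounded second derivatives on a ball. -/
theorem summable_and_fderiv_fderiv_tsum [CompleteSpace F] {g : ι → E → F} {g' : ι → E → E →L[ℝ] F}
    {g'' : ι → E → E →L[ℝ] E →L[ℝ] F} {u : ι → ℝ} {R : ℝ} {p : E} (S : Finset ι)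
    (hu : Summable u) (hp : p ∈ Metric.ball (0 : E) R)
    (hg : ∀ i ∉ S, ∀ x ∈ Metric.ball (0 : E) R, HasFDerivAt (g i) (g' i x) x)
    (hg' : ∀ i ∉ S, ∀ x ∈ Metric.ball (0 : E) R, HasFDerivAt (g' i) (g'' i x) x)
    (hg'' : ∀ i ∉ S, ∀ x ∈ Metric.ball (0 : E) R, ‖g'' i x‖ ≤ u i)
    (hg0 : ∀ i ∉ S, g i 0 = 0) (hg'0 : ∀ i ∉ S, g' i 0 = 0) :
    Summable (fun i => g i p) ∧ Summable (fun i => g'' i p) ∧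
      ((∀ i ∈ S, ∀ᶠ x in 𝓝 p, HasFDerivAt (g i) (g' i x) x) →
        (∀ i ∈ S, HasFDerivAt (g' i) (g'' i p) p) →
          fderiv ℝ (fderiv ℝ fun x => ∑' i, g i x) p = ∑' i, g'' i p) := by
  have hR : 0 < R := Metric.pos_of_mem_ball hp
  have hball : Metric.ball (0 : E) R ∈ 𝓝 p := Metric.isOpen_ball.mem_nhds hp
  have hb' : ∀ i ∉ S, ∀ x ∈ Metric.ball (0 : E) R, ‖g' i x‖ ≤ u i * R := fun i hi x hx =>
    norm_le_mul_of_hasFDerivAt_of_norm_le (hg' i hi) (hg'' i hi) (hg'0 i hi) hx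
  have hb : ∀ i ∉ S, ∀ x ∈ Metric.ball (0 : E) R, ‖g i x‖ ≤ u i * R * R := fun i hi x hx =>
    norm_le_mul_of_hasFDerivAt_of_norm_le (hg i hi) (hb' i hi) (hg0 i hi) hx
  have hcof : ∀ᶠ i in cofinite, i ∉ S := S.finite_toSet.eventually_cofinite_notMem
  have sg : ∀ x ∈ Metric.ball (0 : E) R, Summable fun i => g i x := fun x hx =>
    .of_norm_bounded_eventually ((hu.mul_right R).mul_right R)
      (hcof.mono fun i hi => hb i hi x hx)
  have sg' : ∀ x ∈ Metric.ball (0 : E) R, Summable fun i => g' i x := fun x hx =>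
    .of_norm_bounded_eventually (hu.mul_right R) (hcof.mono fun i hi => hb' i hi x hx)
  have sg'' : Summable fun i => g'' i p :=
    Summable.of_norm_bounded_eventually (f := fun i => g'' i p) hu
      (hcof.mono fun i hi => hg'' i hi p hp)
  refine ⟨sg p hp, sg'', fun hS hS' => ?_⟩
  have hconn := (convex_ball (0 : E) R).isPreconnected
  have hu' : Summable fun i : {i // i ∉ S} => u i := hu.subtype _
  have hd : (fderiv ℝ fun x => ∑' i, g i x) =ᶠ[𝓝 p] fun x => ∑' i, g' i x := by
    have hSall : ∀ᶠ x in 𝓝 p, ∀ i ∈ S, HasFDerivAt (g i) (g' i x) x :=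
      (Finset.eventually_all S).mpr hS
    filter_upwards [hSall, hball] with x hxS hx
    have h1 : HasFDerivAt (fun x => ∑ i ∈ S, g i x + ∑' i : {i // i ∉ S}, g i x)
        (∑ i ∈ S, g' i x + ∑' i : {i // i ∉ S}, g' i x) x :=
      (HasFDerivAt.fun_sum hxS).add <| hasFDerivAt_tsum_of_isPreconnected
        (f := fun (i : {i // i ∉ S}) x => g i x) (f' := fun (i : {i // i ∉ S}) x => g' i x)
        (hu'.mul_right R)
        Metric.isOpen_ball hconn (fun i => hg i i.2) (fun i => hb' i i.2) hx
        ((sg x hx).subtype _) hx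
    rw [(sg' x hx).sum_add_tsum_subtype_compl S] at h1
    refine (h1.congr_of_eventuallyEq ?_).fderiv
    filter_upwards [Metric.isOpen_ball.mem_nhds hx] with y hy
    exact ((sg y hy).sum_add_tsum_subtype_compl S).symm
  rw [hd.fderiv_eq]
  have h2 : HasFDerivAt (fun x => ∑ i ∈ S, g' i x + ∑' i : {i // i ∉ S}, g' i x)
      (∑ i ∈ S, g'' i p + ∑' i : {i // i ∉ S}, g'' i p) p :=
    (HasFDerivAt.fun_sum hS').add <| hasFDerivAt_tsum_of_isPreconnected
      (f := fun (i : {i // i ∉ S}) x => g' i x) (f' := fun (i : {i // i ∉ S}) x => g'' i x) hu'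
      Metric.isOpen_ball hconn (fun i => hg' i i.2) (fun i => hg'' i i.2) hp
      ((sg' p hp).subtype _) hp
  have hsum : ∑ i ∈ S, g'' i p + ∑' i : {i // i ∉ S}, g'' i p = ∑' i, g'' i p :=
    Summable.sum_add_tsum_subtype_compl (f := fun i => g'' i p) sg'' S
  refine ((h2.congr_fderiv hsum).congr_of_eventuallyEq ?_).fderiv
  filter_upwards [hball] with y hy
  exact ((sg' y hy).sum_add_tsum_subtype_compl S).symm

theorem hasSum_apply_apply {f : ι → E →L[ℝ] E →L[ℝ] F} (hf : Summable f) (x y : E) :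
    HasSum (fun i => f i x y) ((∑' i, f i) x y) :=
  (hf.hasSum.mapL (ContinuousLinearMap.apply ℝ (E →L[ℝ] F) x)).mapL
    (ContinuousLinearMap.apply ℝ F y)

end TwiceDifferentiable

section ZetaTerm

variable {A : Type*} [DivisionRing A]

/-- The difference between `(x - w)⁻¹` and its second order Taylor polynomial at `0`. -/
def zetaTerm (w x : A) : A :=
  (x - w)⁻¹ + ∑ μ ∈ Finset.range 3, (w⁻¹ * x) ^ μ * w⁻¹

theorem zetaTerm_eq (w x : A) : zetaTerm w x =
    (x - w)⁻¹ + (w⁻¹ + w⁻¹ * x * w⁻¹ + w⁻¹ * x * w⁻¹ * x * w⁻¹) := by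
  simp [zetaTerm, Finset.sum_range_succ, pow_two, mul_assoc]

theorem zetaTerm_neg (w x : A) : zetaTerm (-w) (-x) = -zetaTerm w x := by
  have : -x - -w = -(x - w) := by abel
  simp only [zetaTerm_eq, this, inv_neg]
  noncomm_ring

end ZetaTerm

section Inverse

variable {A : Type*} [NormedDivisionRing A] [NormedAlgebra ℝ A]

/-- The bilinear map `(h, k) ↦ u h u k u + u k u h u`, the second derivative of inversion at
`u⁻¹`. -/
def invSecondDeriv (u : A) : A →L[ℝ] A →L[ℝ] A :=
  (mulLeftRight ℝ A u).comp (mulLeftRight ℝ A u u) +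
    ((mulLeftRight ℝ A).flip u).comp (mulLeftRight ℝ A u u)

@[simp]
theorem invSecondDeriv_apply (u h k : A) :
    invSecondDeriv u h k = u * k * u * h * u + u * h * u * k * u := by
  simp [invSecondDeriv, mul_assoc]

theorem invSecondDeriv_neg (u : A) : invSecondDeriv (-u) = -invSecondDeriv u := by
  ext h k
  simp [add_comm]

theorem norm_invSecondDeriv_sub_le {u v : A} {M : ℝ} (hu : ‖u‖ ≤ M) (hv : ‖v‖ ≤ M) :
    ‖invSecondDeriv u - invSecondDeriv v‖ ≤ 6 * M ^ 2 * ‖u - v‖ := by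
  have hM : 0 ≤ M := (norm_nonneg u).trans hu
  have key (h k : A) : ‖u * h * u * k * u - v * h * v * k * v‖ ≤
      3 * M ^ 2 * ‖u - v‖ * ‖h‖ * ‖k‖ := by
    have : u * h * u * k * u - v * h * v * k * v =
        (u - v) * h * u * k * u + v * h * (u - v) * k * u + v * h * v * k * (u - v) := by
      noncomm_ring
    rw [this]
    refine (norm_add₃_le).trans ?_
    simp only [norm_mul]
    have h1 : ‖u - v‖ * ‖h‖ * ‖u‖ * ‖k‖ * ‖u‖ ≤ ‖u - v‖ * ‖h‖ * M * ‖k‖ * M := by gcongr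
    have h2 : ‖v‖ * ‖h‖ * ‖u - v‖ * ‖k‖ * ‖u‖ ≤ M * ‖h‖ * ‖u - v‖ * ‖k‖ * M := by gcongr
    have h3 : ‖v‖ * ‖h‖ * ‖v‖ * ‖k‖ * ‖u - v‖ ≤ M * ‖h‖ * M * ‖k‖ * ‖u - v‖ := by gcongr
    linarith
  refine opNorm_le_bound₂ _ (by positivity) fun h k => ?_
  have e : (invSecondDeriv u - invSecondDeriv v) h k =
      (u * k * u * h * u - v * k * v * h * v) + (u * h * u * k * u - v * h * v * k * v) := by
    simp only [sub_apply, invSecondDeriv_apply]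
    abel
  rw [e]
  refine (norm_add_le _ _).trans ?_
  have := key h k
  have := key k h
  linarith

theorem hasFDerivAt_sub_inv {w x : A} (hx : x ≠ w) :
    HasFDerivAt (fun y : A => (y - w)⁻¹) (-mulLeftRight ℝ A (x - w)⁻¹ (x - w)⁻¹) x := by
  have h := (hasFDerivAt_inv' (𝕜 := ℝ) (sub_ne_zero.mpr hx)).comp x
    ((hasFDerivAt_id x).sub_const w)
  simpa [Function.comp_def] using h

theorem hasFDerivAt_neg_mulLeftRight_sub_inv {w x : A} (hx : x ≠ w) :
    HasFDerivAt (fun y : A => -mulLeftRight ℝ A (y - w)⁻¹ (y - w)⁻¹)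
      (invSecondDeriv (x - w)⁻¹) x := by
  have h := hasFDerivAt_sub_inv hx
  have h2 := ((mulLeftRight ℝ A).hasFDerivAt_of_bilinear h h).neg
  refine h2.congr_fderiv ?_
  ext a b
  simp [invSecondDeriv, mul_assoc, add_comm]

theorem hasFDerivAt_zetaTerm {w x : A} (hx : x ≠ w) :
    HasFDerivAt (zetaTerm w) (-mulLeftRight ℝ A (x - w)⁻¹ (x - w)⁻¹ +
      (mulLeftRight ℝ A w⁻¹ w⁻¹ + invSecondDeriv w⁻¹ x)) x := by
  have h1 : HasFDerivAt (fun y : A => w⁻¹ * y * w⁻¹) (mulLeftRight ℝ A w⁻¹ w⁻¹) x :=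
    (mulLeftRight ℝ A w⁻¹ w⁻¹).hasFDerivAt
  have h2 := (h1.mul' (hasFDerivAt_id x)).mul_const' w⁻¹
  have h3 := (hasFDerivAt_sub_inv hx).add ((h1.const_add w⁻¹).add h2)
  have h4 := h3.congr_of_eventuallyEq (Eventually.of_forall fun y => zetaTerm_eq w y)
  refine h4.congr_fderiv ?_
  ext a
  simp [mul_assoc, add_comm]

theorem hasFDerivAt_fderiv_zetaTerm {w x : A} (hx : x ≠ w) :
    HasFDerivAt (fun y : A => -mulLeftRight ℝ A (y - w)⁻¹ (y - w)⁻¹ +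
        (mulLeftRight ℝ A w⁻¹ w⁻¹ + invSecondDeriv w⁻¹ y))
      (invSecondDeriv (x - w)⁻¹ + invSecondDeriv w⁻¹) x :=
  (hasFDerivAt_neg_mulLeftRight_sub_inv hx).add ((invSecondDeriv w⁻¹).hasFDerivAt.const_add _)

theorem norm_invSecondDeriv_add_le {w x : A} {R : ℝ} (hx : ‖x‖ ≤ R) (hw : 2 * R ≤ ‖w‖)
    (hw0 : w ≠ 0) :
    ‖invSecondDeriv (x - w)⁻¹ + invSecondDeriv w⁻¹‖ ≤ 48 * R * ‖w‖⁻¹ ^ 4 := by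
  have hR : 0 ≤ R := (norm_nonneg x).trans hx
  have hw1 : 0 < ‖w‖ := norm_pos_iff.mpr hw0
  have hd : ‖w‖ / 2 ≤ ‖x - w‖ := by
    have := norm_sub_norm_le w x
    rw [norm_sub_rev] at this
    linarith
  have hxw : x - w ≠ 0 := norm_pos_iff.mp (by linarith)
  have hu : ‖(x - w)⁻¹‖ ≤ 2 * ‖w‖⁻¹ := by
    rw [norm_inv, show 2 * ‖w‖⁻¹ = (‖w‖ / 2)⁻¹ by field_simp]
    gcongr
  have hv : ‖-w⁻¹‖ ≤ 2 * ‖w‖⁻¹ := by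
    rw [norm_neg, norm_inv]
    have := inv_pos.mpr hw1
    linarith
  have e : (x - w)⁻¹ - -w⁻¹ = (x - w)⁻¹ * x * w⁻¹ := by
    have : (x - w)⁻¹ * x * w⁻¹ = (x - w)⁻¹ * ((x - w) + w) * w⁻¹ := by rw [sub_add_cancel]
    rw [this, mul_add, add_mul, inv_mul_cancel₀ hxw, mul_assoc _ w, mul_inv_cancel₀ hw0]
    simp [add_comm]
  have h := norm_invSecondDeriv_sub_le hu hv
  rw [invSecondDeriv_neg, sub_neg_eq_add] at h
  refine h.trans ?_
  rw [e, norm_mul, norm_mul, norm_inv w]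
  calc 6 * (2 * ‖w‖⁻¹) ^ 2 * (‖(x - w)⁻¹‖ * ‖x‖ * ‖w‖⁻¹)
      ≤ 6 * (2 * ‖w‖⁻¹) ^ 2 * (2 * ‖w‖⁻¹ * R * ‖w‖⁻¹) := by gcongr
    _ = 48 * R * ‖w‖⁻¹ ^ 4 := by ring

/-- The second difference of `zetaTerm w` about `a`, corrected by its second derivative,
changes sign when `w` is reflected to `2 * a - w`. -/
theorem secondDifference_zetaTerm (w a y : A) :
    zetaTerm w (y + a) + zetaTerm w (a - y) - 2 * zetaTerm w a -
      (invSecondDeriv (a - w)⁻¹ + invSecondDeriv w⁻¹) y y =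
    (y + (a - w))⁻¹ - (y - (a - w))⁻¹ - 2 * (a - w)⁻¹ - invSecondDeriv (a - w)⁻¹ y y := by
  have h1 : a - y - w = -(y - (a - w)) := by abel
  have h2 : y + a - w = y + (a - w) := by abel
  simp only [zetaTerm_eq, h1, h2, inv_neg, add_apply, invSecondDeriv_apply]
  noncomm_ring

end Inverse

section Lattice

theorem wk_eq_linearMap (ω : Fin 3 → Quaternion ℝ) (k : Fin 3 → ℤ) :
    wk ω k = ((2 : ℝ) • Fintype.linearCombination ℝ ω) fun i => (k i : ℝ) := by
  simp [wk, Fintype.linearCombination_apply, two_smul, two_mul]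

theorem wk_zero (ω : Fin 3 → Quaternion ℝ) : wk ω 0 = 0 := by
  simp [wk]

theorem wk_neg (ω : Fin 3 → Quaternion ℝ) (k : Fin 3 → ℤ) : wk ω (-k) = -wk ω k := by
  simp [wk]

theorem wk_sub (ω : Fin 3 → Quaternion ℝ) (k l : Fin 3 → ℤ) :
    wk ω (k - l) = wk ω k - wk ω l := by
  simp [wk, sub_smul, mul_sub]

variable {ω : Fin 3 → Quaternion ℝ}

theorem injective_two_smul_linearCombination (hω : LinearIndependent ℝ ω) :
    Function.Injective ((2 : ℝ) • Fintype.linearCombination ℝ ω) := by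
  intro a b hab
  refine hω.fintypeLinearCombination_injective ?_
  simpa using hab

theorem wk_eq_zero_iff (hω : LinearIndependent ℝ ω) {k : Fin 3 → ℤ} : wk ω k = 0 ↔ k = 0 := by
  refine ⟨fun h => ?_, fun h => by rw [h, wk_zero]⟩
  rw [wk_eq_linearMap] at h
  have h0 := injective_two_smul_linearCombination hω (h.trans (map_zero _).symm)
  ext i
  simpa using congrFun h0 i

theorem summable_norm_wk_inv_pow_four (hω : LinearIndependent ℝ ω) :
    Summable fun k => ‖wk ω k‖⁻¹ ^ 4 := by
  simp_rw [wk_eq_linearMap]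
  exact summable_norm_inv_pow_four_of_injective _ (injective_two_smul_linearCombination hω)

theorem eventually_le_norm_wk (hω : LinearIndependent ℝ ω) {R : ℝ} (hR : 0 < R) :
    ∀ᶠ k in cofinite, wk ω k ≠ 0 ∧ R ≤ ‖wk ω k‖ := by
  have h0 : ∀ᶠ k : Fin 3 → ℤ in cofinite, k ≠ 0 := by simp [eventually_cofinite]
  have h1 := (summable_norm_wk_inv_pow_four hω).tendsto_cofinite_zero.eventually_lt_const
    (show (0 : ℝ) < R⁻¹ ^ 4 by positivity)
  filter_upwards [h0, h1] with k hk hk'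
  have hw : wk ω k ≠ 0 := (wk_eq_zero_iff hω).not.mpr hk
  refine ⟨hw, ?_⟩
  have := lt_of_pow_lt_pow_left₀ 4 (by positivity) hk'
  exact ((inv_lt_inv₀ (norm_pos_iff.mpr hw) hR).mp this).le

theorem summable_and_fderiv_fderiv_tsum_zetaTerm (hω : LinearIndependent ℝ ω) (p : Quaternion ℝ) :
    Summable (fun k => zetaTerm (wk ω k) p) ∧
      Summable (fun k => invSecondDeriv (p - wk ω k)⁻¹ + invSecondDeriv (wk ω k)⁻¹) ∧
      (p ∉ Set.range (wk ω) →
        fderiv ℝ (fderiv ℝ fun x => ∑' k, zetaTerm (wk ω k) x) p =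
          ∑' k, (invSecondDeriv (p - wk ω k)⁻¹ + invSecondDeriv (wk ω k)⁻¹)) := by
  set R : ℝ := ‖p‖ + 1 with hRdef
  have hR : 0 < R := by positivity
  have hfin := eventually_le_norm_wk hω (R := 2 * R) (by positivity)
  rw [eventually_cofinite] at hfin
  have hS : ∀ k ∉ hfin.toFinset, wk ω k ≠ 0 ∧ 2 * R ≤ ‖wk ω k‖ := fun k hk => by
    simpa only [Set.Finite.mem_toFinset, Set.mem_ofPred_eq, not_not] using hk
  have hne : ∀ k ∉ hfin.toFinset, ∀ x ∈ Metric.ball (0 : Quaternion ℝ) R, x ≠ wk ω k := by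
    rintro k hk x hx rfl
    have := (hS k hk).2
    rw [mem_ball_zero_iff] at hx
    linarith
  obtain ⟨h1, h2, h3⟩ := summable_and_fderiv_fderiv_tsum (p := p) (R := R)
    (g := fun k => zetaTerm (wk ω k))
    (g'' := fun k x => invSecondDeriv (x - wk ω k)⁻¹ + invSecondDeriv (wk ω k)⁻¹)
    (u := fun k => 48 * R * ‖wk ω k‖⁻¹ ^ 4)
    hfin.toFinset ((summable_norm_wk_inv_pow_four hω).mul_left _)
    (by simp [hRdef])
    (fun k hk x hx => hasFDerivAt_zetaTerm (hne k hk x hx))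
    (fun k hk x hx => hasFDerivAt_fderiv_zetaTerm (hne k hk x hx))
    (fun k hk x hx => norm_invSecondDeriv_add_le (mem_ball_zero_iff.mp hx).le (hS k hk).2
      (hS k hk).1)
    (fun k _ => by simp [zetaTerm_eq])
    (fun k _ => by simp)
  refine ⟨h1, h2, fun hp => h3 (fun k _ => ?_) fun k _ => ?_⟩
  · have hpk : p ≠ wk ω k := fun h => hp ⟨k, h.symm⟩
    filter_upwards [isOpen_ne.mem_nhds hpk] with x hx
    exact hasFDerivAt_zetaTerm hx
  · exact hasFDerivAt_fderiv_zetaTerm fun h => hp ⟨k, h.symm⟩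

theorem zeta3_eq_tsum (hω : LinearIndependent ℝ ω) :
    zeta3 ω = fun x => ∑' k, zetaTerm (wk ω k) x := by
  funext x
  have h := (summable_and_fderiv_fderiv_tsum_zetaTerm hω x).1.sum_add_tsum_subtype_compl {0}
  have e := (Equiv.subtypeEquivRight (p := fun k : Fin 3 → ℤ => k ∉ ({0} : Finset _))
    (q := (· ≠ 0)) (by simp)).tsum_eq fun k => zetaTerm (wk ω k.1) x
  simp only [← h, Finset.sum_singleton]
  refine congrArg₂ (· + ·) (by simp [zetaTerm_eq, wk_zero]) e.symm

theorem zeta3_neg (hω : LinearIndependent ℝ ω) (x : Quaternion ℝ) :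
    zeta3 ω (-x) = -zeta3 ω x := by
  simp only [zeta3_eq_tsum hω]
  rw [← (Equiv.neg (Fin 3 → ℤ)).tsum_eq, ← tsum_neg]
  simp only [Equiv.neg_apply, wk_neg, zetaTerm_neg]

end Lattice

/-- Quasi-periodicity of `ζ₃`: for a half-period `ϖ` and `x` off the lattice,
`ζ₃(x + 2ϖ) − ζ₃(x) = 2ζ₃(ϖ) + ((x+ϖ)|∇)² ζ₃ (ϖ)`. -/
theorem zeta3_quasiperiodic (ω : Fin 3 → Quaternion ℝ)
    (hω : LinearIndependent ℝ ω) (ϖ : Quaternion ℝ)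
    (hϖ1 : 2 * ϖ ∈ Set.range (wk ω)) (hϖ2 : ϖ ∉ Set.range (wk ω))
    (x : Quaternion ℝ) (hx : x ∉ Set.range (wk ω)) :
    zeta3 ω (x + 2 * ϖ) - zeta3 ω x =
      2 * zeta3 ω ϖ + (iteratedFDeriv ℝ 2 (zeta3 ω) ϖ) (fun _ => x + ϖ) := by
  obtain ⟨m, hm⟩ := hϖ1
  obtain ⟨y, rfl⟩ : ∃ y, x = y - ϖ := ⟨x + ϖ, by abel⟩
  have e1 : y - ϖ + 2 * ϖ = y + ϖ := by rw [two_mul]; abel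
  have e2 : zeta3 ω (y - ϖ) = -zeta3 ω (ϖ - y) := by rw [← zeta3_neg hω, neg_sub]
  obtain ⟨s0, s0'', hd⟩ := summable_and_fderiv_fderiv_tsum_zetaTerm hω ϖ
  have s1 := (summable_and_fderiv_fderiv_tsum_zetaTerm hω (y + ϖ)).1
  have s2 := (summable_and_fderiv_fderiv_tsum_zetaTerm hω (ϖ - y)).1
  have s3 := hasSum_apply_apply s0'' y y
  have hd2 : iteratedFDeriv ℝ 2 (zeta3 ω) ϖ (fun _ => y) =
      ∑' k, (invSecondDeriv (ϖ - wk ω k)⁻¹ + invSecondDeriv (wk ω k)⁻¹) y y := by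
    rw [iteratedFDeriv_two_apply, zeta3_eq_tsum hω, hd hϖ2]
    exact s3.tsum_eq.symm
  have hsum : zeta3 ω (y + ϖ) + zeta3 ω (ϖ - y) - 2 * zeta3 ω ϖ -
      ∑' k, (invSecondDeriv (ϖ - wk ω k)⁻¹ + invSecondDeriv (wk ω k)⁻¹) y y =
      ∑' k, ((y + (ϖ - wk ω k))⁻¹ - (y - (ϖ - wk ω k))⁻¹ - 2 * (ϖ - wk ω k)⁻¹ -
        invSecondDeriv (ϖ - wk ω k)⁻¹ y y) := by
    simp only [← secondDifference_zetaTerm, zeta3_eq_tsum hω]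
    rw [((s1.add s2).sub (s0.mul_left 2)).tsum_sub s3.summable, (s1.add s2).tsum_sub (s0.mul_left 2),
      s1.tsum_add s2, s0.tsum_mul_left]
  have hodd : ∑' k, ((y + (ϖ - wk ω k))⁻¹ - (y - (ϖ - wk ω k))⁻¹ - 2 * (ϖ - wk ω k)⁻¹ -
      invSecondDeriv (ϖ - wk ω k)⁻¹ y y) = 0 := by
    have : IsAddTorsionFree (Quaternion ℝ) := .of_isTorsionFree ℝ _
    rw [← self_eq_neg, ← tsum_neg]
    conv_lhs => rw [← (Equiv.subLeft m).tsum_eq]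
    refine tsum_congr fun k => ?_
    have hr : ϖ - wk ω (m - k) = -(ϖ - wk ω k) := by
      rw [wk_sub, hm, two_mul]
      abel
    simp only [Equiv.subLeft_apply, hr, inv_neg, invSecondDeriv_neg, neg_apply, sub_neg_eq_add,
      ← sub_eq_add_neg]
    noncomm_ring
  rw [e1, e2, sub_add_cancel, hd2]
  rw [hodd] at hsum
  rw [sub_neg_eq_add]
  rwa [sub_sub, sub_eq_zero] at hsum

end
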